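/- Let t be a natural number with t ≥ 2 and set s = t + t². Then there does not exist a generalised hexagon of order (s, t). -/

import Mathlib

/-- An incidence structure of points and lines, each line being a set of points. -/
structure GenHexagon where
  Point : Type
  Line : Type
  pts : Line → Set Point

namespace GenHexagon

variable (Γ : GenHexagon)

/-- Adjacency of the bipartite incidence graph on the disjoint union of points and lines:
a point is adjacent to a line iff the point lies on the line. -/
def incAdj : Γ.Point ⊕ Γ.Line → Γ.Point ⊕ Γ.Line → Prop
  | Sum.inl x, Sum.inr L => x ∈ Γ.pts L
  | Sum.inr L, Sum.inl x => x ∈ Γ.pts L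
  | _, _ => False

/-- The bipartite incidence graph. -/
def incGraph : SimpleGraph (Γ.Point ⊕ Γ.Line) where
  Adj := Γ.incAdj
  symm := ⟨by rintro (x | L) (y | M) h <;> simp_all [incAdj]⟩
  loopless := ⟨by rintro (x | L) h <;> simp_all [incAdj]⟩

/-- `Γ` is a generalised hexagon: its incidence graph has diameter `6` and girth `12`. -/
def IsGenHexagon : Prop :=
  Γ.incGraph.ediam = 6 ∧ Γ.incGraph.egirth = 12

/-- Two points are collinear if they are distinct and some line contains both. -/
def Collinear (x y : Γ.Point) : Prop :=
  x ≠ y ∧ ∃ L, x ∈ Γ.pts L ∧ y ∈ Γ.pts L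

/-- Two points are special if they are distinct, non-collinear, and collinear
to a common point. -/
def Special (x y : Γ.Point) : Prop :=
  x ≠ y ∧ ¬ Γ.Collinear x y ∧ ∃ z, Γ.Collinear x z ∧ Γ.Collinear y z

/-- Two points are opposite if they are distinct, non-collinear and non-special. -/
def Opposite (x y : Γ.Point) : Prop :=
  x ≠ y ∧ ¬ Γ.Collinear x y ∧ ¬ Γ.Special x y

/-- `Γ` has order `(s, t)`: every line contains exactly `s + 1` points and every
point lies on exactly `t + 1` lines. -/
def HasOrder (s t : ℕ) : Prop :=
  (∀ L, (Γ.pts L).encard = s + 1) ∧ (∀ x, {L | x ∈ Γ.pts L}.encard = t + 1)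

/-- `Γ` is thick: every line contains at least `3` points and every point lies on
at least `3` lines. -/
def Thick : Prop :=
  (∀ L, 3 ≤ (Γ.pts L).encard) ∧ (∀ x, 3 ≤ {L | x ∈ Γ.pts L}.encard)

/-- A point is close to a line if it is collinear to exactly one point of that line. -/
def CloseTo (x : Γ.Point) (L : Γ.Line) : Prop :=
  ∃! y, y ∈ Γ.pts L ∧ Γ.Collinear x y

/-- Two lines are opposite if they are disjoint and no point of one is collinear to
a point of the other. -/
def OppLines (L M : Γ.Line) : Prop :=
  (∀ x ∈ Γ.pts L, x ∉ Γ.pts M) ∧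
  (∀ x ∈ Γ.pts L, ∀ y ∈ Γ.pts M, ¬ Γ.Collinear x y)

/-- The distance-3 trace `[L,M]₃` of two (opposite) lines: the set of points close to
both `L` and `M`. -/
def trace3 (L M : Γ.Line) : Set Γ.Point :=
  {x | Γ.CloseTo x L ∧ Γ.CloseTo x M}

/-- The distance-3 trace `[L,M]₃` is regular if `[N,M]₃ = [L,M]₃` for every line `N`
opposite `M` such that `[N,M]₃` and `[L,M]₃` share at least two points. -/
def RegularTrace3 (L M : Γ.Line) : Prop :=
  ∀ N, Γ.OppLines N M → (Γ.trace3 N M ∩ Γ.trace3 L M).Nontrivial →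
    Γ.trace3 N M = Γ.trace3 L M

/-- A hyperbolic line: a set `H` of pairwise special points, all collinear to a common
point `p`, such that for every point `q` opposite `p` to which at least two points of `H`
are special, the set of points special to `q` and collinear to `p` equals `H`. -/
def IsHyperbolicLine (H : Set Γ.Point) : Prop :=
  (∀ x ∈ H, ∀ y ∈ H, x ≠ y → Γ.Special x y) ∧
  ∃ p, (∀ x ∈ H, Γ.Collinear x p) ∧
    ∀ q, Γ.Opposite q p → {x ∈ H | Γ.Special q x}.Nontrivial →
      {x | Γ.Special q x ∧ Γ.Collinear x p} = H

/-- A round-up triple: no point of `Γ` is opposite exactly one of `x₁, x₂, x₃`. -/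
def RoundUpTriple (x₁ x₂ x₃ : Γ.Point) : Prop :=
  ∀ y : Γ.Point,
    ¬ ((Γ.Opposite y x₁ ∧ ¬ Γ.Opposite y x₂ ∧ ¬ Γ.Opposite y x₃) ∨
       (¬ Γ.Opposite y x₁ ∧ Γ.Opposite y x₂ ∧ ¬ Γ.Opposite y x₃) ∨
       (¬ Γ.Opposite y x₁ ∧ ¬ Γ.Opposite y x₂ ∧ Γ.Opposite y x₃))

/-- A geometric line: a set `T` of points such that each point of `Γ` is either opposite
no member of `T`, or non-opposite to exactly one member of `T`. -/
def IsGeometricLine (T : Set Γ.Point) : Prop :=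
  ∀ y : Γ.Point, (∀ x ∈ T, ¬ Γ.Opposite y x) ∨ (∃! x, x ∈ T ∧ ¬ Γ.Opposite y x)

end GenHexagon

namespace SimpleGraph

variable {V : Type*} {G : SimpleGraph V}

/-- Two distinct paths with the same ends close up to a cycle, so the girth is at most the sum of
their lengths. -/
theorem egirth_le_add_length_of_isPath_ne {u v : V} {p q : G.Walk u v} (hp : p.IsPath)
    (hq : q.IsPath) (hne : p ≠ q) : G.egirth ≤ (p.length + q.length : ℕ) := by
  classical
  let S : Set (Sym2 V) := {a | a ∈ p.edges ++ q.edges}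
  let H : SimpleGraph V := fromEdgeSet S
  have mem_H : ∀ {a}, a ∈ G.edgeSet → a ∈ p.edges ++ q.edges → a ∈ H.edgeSet := by
    intro a ha ha'
    rw [edgeSet_fromEdgeSet]
    exact ⟨ha', fun h => G.not_isDiag_of_mem_edgeSet ha h⟩
  have hpH : ∀ a ∈ p.edges, a ∈ H.edgeSet := fun a ha =>
    mem_H (p.edges_subset_edgeSet ha) (by simp [ha])
  have hqH : ∀ a ∈ q.edges, a ∈ H.edgeSet := fun a ha =>
    mem_H (q.edges_subset_edgeSet ha) (by simp [ha])
  have hHG : H ≤ G := by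
    intro a b hab
    have hab' : s(a, b) ∈ p.edges ++ q.edges := ((fromEdgeSet_adj S).1 hab).1
    rcases List.mem_append.1 hab' with h | h
    · exact p.edges_subset_edgeSet h
    · exact q.edges_subset_edgeSet h
  have hcyc : ¬ H.IsAcyclic := by
    intro hac
    have := hac.subsingleton_path u v
    have key := congrArg Subtype.val
      (Subsingleton.elim (α := H.Path u v) ⟨p.transfer H hpH, hp.transfer hpH⟩ ⟨q.transfer H hqH, hq.transfer hqH⟩)
    have key' := congrArg (fun w : H.Walk u v => (w.mapLe hHG).support) key
    exact hne (Walk.ext_support (by simpa using key'))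
  obtain ⟨a, w, hw, hlen⟩ := exists_egirth_eq_length.2 hcyc
  calc G.egirth ≤ H.egirth := egirth_anti hHG
    _ = w.length := hlen
    _ ≤ (p.length + q.length : ℕ) := by
      have hsub : w.edges ⊆ p.edges ++ q.edges := fun b hb =>
        ((edgeSet_fromEdgeSet (s := S) ▸ w.edges_subset_edgeSet hb : b ∈ S \ _)).1
      have := (hw.edges_nodup.subperm hsub).length_le
      simp only [List.length_append, Walk.length_edges] at this
      exact_mod_cast this

/-- In a connected graph, a vertex at positive distance less than half the girth has a unique
neighbour that is closer to the base vertex. -/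
theorem Connected.existsUnique_adj_dist_add_one (hG : G.Connected) {x v : V}
    (hpos : G.dist x v ≠ 0) (hgirth : ((2 * G.dist x v : ℕ) : ℕ∞) < G.egirth) :
    ∃! u, G.Adj v u ∧ G.dist x u + 1 = G.dist x v := by
  have exists_path : ∀ u, G.Adj v u → G.dist x u + 1 = G.dist x v →
      ∃ p : G.Walk x v, p.IsPath ∧ p.length = G.dist x v ∧ p.penultimate = u := by
    intro u huv hu
    obtain ⟨p, hp⟩ := hG.exists_walk_length_eq_dist x u
    have hl : (p.concat huv.symm).length = G.dist x v := by simp [hp, hu]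
    exact ⟨p.concat huv.symm, Walk.isPath_of_length_eq_dist _ hl, hl, by simp⟩
  have hex : ∃ u, G.Adj v u ∧ G.dist x u + 1 = G.dist x v := by
    obtain ⟨p, hp⟩ := hG.exists_walk_length_eq_dist x v
    have hnil : ¬ p.Nil := by
      intro h
      exact hpos (hp ▸ Walk.length_eq_zero_iff.2 h)
    refine ⟨p.penultimate, (p.adj_penultimate hnil).symm, ?_⟩
    have h1 := dist_le p.dropLast
    have h2 := hG.dist_triangle (u := x) (v := p.penultimate) (w := v)
    have h3 := dist_eq_one_iff_adj.2 (p.adj_penultimate hnil)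
    simp only [Walk.length_dropLast] at h1
    omega
  obtain ⟨u, hu⟩ := hex
  refine ⟨u, hu, fun u' hu' => ?_⟩
  obtain ⟨p, hp, hpl, rfl⟩ := exists_path u hu.1 hu.2
  obtain ⟨q, hq, hql, rfl⟩ := exists_path u' hu'.1 hu'.2
  by_contra hne
  have hle := egirth_le_add_length_of_isPath_ne hp hq (fun h => hne (by rw [h]))
  rw [hpl, hql, ← two_mul] at hle
  exact absurd hle (not_le.2 hgirth)

/-- A connected graph of finite diameter with finite neighbourhoods is finite. -/
theorem Connected.finite_of_dist_le (hG : G.Connected)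
    (hfin : ∀ v, (G.neighborSet v).Finite) {n : ℕ} (hn : ∀ u v, G.dist u v ≤ n) :
    Finite V := by
  obtain ⟨x⟩ := hG.nonempty
  have hball : ∀ k : ℕ, {v | ∃ p : G.Walk x v, p.length = k}.Finite := by
    intro k
    induction k with
    | zero =>
      refine (Set.finite_singleton x).subset ?_
      rintro v ⟨p, hp⟩
      exact (Walk.eq_of_length_eq_zero hp).symm
    | succ k ih =>
      refine (ih.biUnion fun v _ => hfin v).subset ?_
      rintro v ⟨p, hp⟩
      have hnil : ¬ p.Nil := fun h => by
        have := Walk.length_eq_zero_iff.2 h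
        omega
      refine Set.mem_biUnion (x := p.penultimate) ⟨p.dropLast, by simp [hp]⟩ ?_
      exact p.adj_penultimate hnil
  refine Set.finite_univ_iff.1 (((Set.finite_Iic n).biUnion fun k _ => hball k).subset ?_)
  intro v _
  obtain ⟨p, hp⟩ := hG.exists_walk_length_eq_dist x v
  exact Set.mem_biUnion (x := G.dist x v) (hn x v) ⟨p, hp⟩

end SimpleGraph

/-- The trace of a matrix `K` with `K * K = κ • K`, `κ ≠ 0`, is a natural multiple of `κ`. -/
theorem Matrix.exists_nat_trace_eq_mul {n F : Type*} [Fintype n] [DecidableEq n] [Field F]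
    {K : Matrix n n F} {κ : F} (hκ : κ ≠ 0) (hK : K * K = κ • K) :
    ∃ m : ℕ, K.trace = κ * m := by
  have hE : IsIdempotentElem (κ⁻¹ • K) := by
    rw [IsIdempotentElem, smul_mul_smul_comm, hK, smul_smul]
    congr 1
    field_simp
  have hE' : IsIdempotentElem (Matrix.toLin' (κ⁻¹ • K)) := by
    rw [IsIdempotentElem, Module.End.mul_eq_comp, ← Matrix.toLin'_mul, hE.eq]
  refine ⟨Module.finrank F (LinearMap.range (Matrix.toLin' (κ⁻¹ • K))), ?_⟩
  rw [← (LinearMap.IsIdempotentElem.isProj_range _ hE').trace, Matrix.trace_toLin'_eq, Matrix.trace_smul, smul_eq_mul]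
  field_simp

namespace GenHexagon

variable {Γ : GenHexagon} {s t : ℕ}

/-- The distance in the incidence graph between two points. -/
noncomputable def ptDist (Γ : GenHexagon) (x y : Γ.Point) : ℕ :=
  Γ.incGraph.dist (Sum.inl x) (Sum.inl y)

/-- The distance in the incidence graph between a point and a line. -/
noncomputable def lineDist (Γ : GenHexagon) (x : Γ.Point) (L : Γ.Line) : ℕ :=
  Γ.incGraph.dist (Sum.inl x) (Sum.inr L)

theorem incGraph_adj_inl_inr {x : Γ.Point} {L : Γ.Line} :
    Γ.incGraph.Adj (Sum.inl x) (Sum.inr L) ↔ x ∈ Γ.pts L := Iff.rfl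

/-- The two-colouring of the incidence graph with the points as one colour class. -/
def incColoring (Γ : GenHexagon) : Γ.incGraph.Coloring Bool :=
  SimpleGraph.Coloring.mk Sum.isLeft (by
    rintro (x | L) (y | M) h <;> simp_all [incGraph, incAdj])

theorem ptDist_self (x : Γ.Point) : Γ.ptDist x x = 0 := SimpleGraph.dist_self

theorem ptDist_comm (x y : Γ.Point) : Γ.ptDist x y = Γ.ptDist y x := SimpleGraph.dist_comm

namespace IsGenHexagon

theorem nonempty_vertex (hΓ : Γ.IsGenHexagon) : Nonempty (Γ.Point ⊕ Γ.Line) := by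
  have := SimpleGraph.nontrivial_of_ediam_ne_zero (G := Γ.incGraph) (by rw [hΓ.1]; norm_num)
  infer_instance

theorem connected (hΓ : Γ.IsGenHexagon) : Γ.incGraph.Connected := by
  have := hΓ.nonempty_vertex
  exact SimpleGraph.connected_of_ediam_ne_top (by rw [hΓ.1]; decide)

theorem dist_le_six (hΓ : Γ.IsGenHexagon) (u v : Γ.Point ⊕ Γ.Line) :
    Γ.incGraph.dist u v ≤ 6 := by
  have h := SimpleGraph.edist_le_ediam (G := Γ.incGraph) (u := u) (v := v)
  rw [hΓ.1, ← (hΓ.connected u v).coe_dist_eq_edist] at h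
  exact_mod_cast h

theorem ptDist_le (hΓ : Γ.IsGenHexagon) (x y : Γ.Point) : Γ.ptDist x y ≤ 6 :=
  hΓ.dist_le_six _ _

theorem even_ptDist (hΓ : Γ.IsGenHexagon) (x y : Γ.Point) : Even (Γ.ptDist x y) := by
  obtain ⟨p, hp⟩ := hΓ.connected.exists_walk_length_eq_dist (Sum.inl x) (Sum.inl y)
  rw [ptDist, ← hp, Γ.incColoring.even_length_iff_congr p]
  exact Iff.rfl

theorem odd_lineDist (hΓ : Γ.IsGenHexagon) (x : Γ.Point) (L : Γ.Line) :
    Odd (Γ.lineDist x L) := by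
  obtain ⟨p, hp⟩ := hΓ.connected.exists_walk_length_eq_dist (Sum.inl x) (Sum.inr L)
  rw [lineDist, ← hp, Γ.incColoring.odd_length_iff_not_congr p]
  change ¬ true = true ↔ false = true
  simp

theorem lineDist_mem (hΓ : Γ.IsGenHexagon) (x : Γ.Point) (L : Γ.Line) :
    Γ.lineDist x L = 1 ∨ Γ.lineDist x L = 3 ∨ Γ.lineDist x L = 5 := by
  have h1 := hΓ.dist_le_six (Sum.inl x) (Sum.inr L)
  obtain ⟨k, hk⟩ := hΓ.odd_lineDist x L
  rw [← lineDist] at h1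
  omega

theorem ptDist_mem (hΓ : Γ.IsGenHexagon) (x y : Γ.Point) :
    Γ.ptDist x y = 0 ∨ Γ.ptDist x y = 2 ∨ Γ.ptDist x y = 4 ∨ Γ.ptDist x y = 6 := by
  have h1 := hΓ.ptDist_le x y
  obtain ⟨k, hk⟩ := hΓ.even_ptDist x y
  omega

theorem ptDist_eq_zero_iff (hΓ : Γ.IsGenHexagon) {x y : Γ.Point} :
    Γ.ptDist x y = 0 ↔ x = y := by
  rw [ptDist, hΓ.connected.dist_eq_zero_iff, Sum.inl.injEq]

/-- The distances from a point to the two members of a flag differ by one. -/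
theorem ptDist_lineDist_of_mem (hΓ : Γ.IsGenHexagon) (x : Γ.Point) {y : Γ.Point} {L : Γ.Line}
    (hy : y ∈ Γ.pts L) :
    Γ.ptDist x y = Γ.lineDist x L + 1 ∨ Γ.ptDist x y + 1 = Γ.lineDist x L := by
  have h := (incGraph_adj_inl_inr.2 hy).diff_dist_adj (u := Sum.inl x)
  obtain ⟨k, hk⟩ := hΓ.even_ptDist x y
  obtain ⟨l, hl⟩ := hΓ.odd_lineDist x L
  rw [ptDist, lineDist] at *
  omega

/-- Every line has a unique point nearest to a given point. -/
theorem existsUnique_mem_pts (hΓ : Γ.IsGenHexagon) (x : Γ.Point) (L : Γ.Line) :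
    ∃! w, w ∈ Γ.pts L ∧ Γ.ptDist x w + 1 = Γ.lineDist x L := by
  have h := hΓ.lineDist_mem x L
  obtain ⟨v, ⟨hv, hv'⟩, huniq⟩ := hΓ.connected.existsUnique_adj_dist_add_one
    (x := Sum.inl x) (v := Sum.inr L) (by rw [← lineDist]; omega)
    (by rw [hΓ.2, ← lineDist]; exact_mod_cast (by omega : 2 * Γ.lineDist x L < 12))
  rcases v with w | M
  · exact ⟨w, ⟨hv, hv'⟩, fun w' hw' => Sum.inl_injective (huniq (Sum.inl w') hw')⟩
  · exact absurd hv id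

/-- A point neither equal nor opposite to `x` is on a unique line nearest to `x`. -/
theorem existsUnique_line (hΓ : Γ.IsGenHexagon) (x : Γ.Point) {y : Γ.Point}
    (h0 : Γ.ptDist x y ≠ 0) (h6 : Γ.ptDist x y ≠ 6) :
    ∃! L, y ∈ Γ.pts L ∧ Γ.lineDist x L + 1 = Γ.ptDist x y := by
  have h := hΓ.ptDist_mem x y
  obtain ⟨v, ⟨hv, hv'⟩, huniq⟩ := hΓ.connected.existsUnique_adj_dist_add_one
    (x := Sum.inl x) (v := Sum.inl y) h0
    (by rw [hΓ.2, ← ptDist]; exact_mod_cast (by omega : 2 * Γ.ptDist x y < 12))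
  rcases v with w | M
  · exact absurd hv id
  · exact ⟨M, ⟨hv, hv'⟩, fun M' hM' => Sum.inr_injective (huniq (Sum.inr M') hM')⟩

end IsGenHexagon

theorem HasOrder.nonempty_point (hO : Γ.HasOrder s t) (hΓ : Γ.IsGenHexagon) :
    Nonempty Γ.Point := by
  obtain ⟨x | L⟩ := hΓ.nonempty_vertex
  · exact ⟨x⟩
  · obtain ⟨x, -⟩ := Set.encard_ne_zero.1 (show (Γ.pts L).encard ≠ 0 by rw [hO.1]; simp)
    exact ⟨x⟩

theorem HasOrder.finite_vertex (hO : Γ.HasOrder s t) (hΓ : Γ.IsGenHexagon) :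
    Finite (Γ.Point ⊕ Γ.Line) := by
  refine hΓ.connected.finite_of_dist_le ?_ hΓ.dist_le_six
  rintro (x | L)
  · refine ((Set.finite_of_encard_eq_coe (k := t + 1) (s := {L | x ∈ Γ.pts L})
      (by simpa using hO.2 x)).image Sum.inr).subset ?_
    rintro (y | M) h
    · exact absurd h id
    · exact ⟨M, h, rfl⟩
  · refine ((Set.finite_of_encard_eq_coe (k := s + 1) (s := Γ.pts L)
      (by simpa using hO.1 L)).image Sum.inl).subset ?_
    rintro (y | M) h
    · exact ⟨y, h, rfl⟩
    · exact absurd h id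

section Counting

open scoped Classical

theorem HasOrder.card_pts [Fintype Γ.Point] (hO : Γ.HasOrder s t) (L : Γ.Line) :
    (Finset.univ.filter (· ∈ Γ.pts L)).card = s + 1 := by
  have h := hO.1 L
  rw [← Set.coe_toFinset (Γ.pts L), Set.encard_coe_eq_coe_finsetCard] at h
  have h' : (Γ.pts L).toFinset = Finset.univ.filter (· ∈ Γ.pts L) := by ext; simp
  rw [h'] at h
  exact_mod_cast h

theorem HasOrder.card_lines [Fintype Γ.Line] (hO : Γ.HasOrder s t) (x : Γ.Point) :
    (Finset.univ.filter (x ∈ Γ.pts ·)).card = t + 1 := by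
  have h := hO.2 x
  rw [← Set.coe_toFinset {L | x ∈ Γ.pts L}, Set.encard_coe_eq_coe_finsetCard] at h
  have h' : {L | x ∈ Γ.pts L}.toFinset = Finset.univ.filter (x ∈ Γ.pts ·) := by ext; simp
  rw [h'] at h
  exact_mod_cast h

/-- The number of lines through `y` at distance `k` from `x`. -/
noncomputable def numLines (Γ : GenHexagon) [Fintype Γ.Line] (x : Γ.Point) (k : ℕ)
    (y : Γ.Point) : ℕ :=
  (Finset.univ.filter fun L => y ∈ Γ.pts L ∧ Γ.lineDist x L = k).card

theorem numLines_of_forall [Fintype Γ.Line] (hO : Γ.HasOrder s t) {x y : Γ.Point} {k : ℕ}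
    (h : ∀ L, y ∈ Γ.pts L → Γ.lineDist x L = k) : Γ.numLines x k y = t + 1 := by
  rw [numLines, ← hO.card_lines y]
  congr 1
  ext L
  simpa using h L

theorem numLines_pred [Fintype Γ.Line] (hΓ : Γ.IsGenHexagon) {x y : Γ.Point} {k : ℕ}
    (hy : Γ.ptDist x y = k + 1) (h6 : Γ.ptDist x y ≠ 6) : Γ.numLines x k y = 1 := by
  obtain ⟨L, hL, huniq⟩ := hΓ.existsUnique_line x (y := y) (by omega) h6
  rw [numLines, Finset.card_eq_one]
  refine ⟨L, ?_⟩
  ext M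
  simp only [Finset.mem_filter, Finset.mem_univ, true_and, Finset.mem_singleton]
  constructor
  · rintro ⟨h1, h2⟩
    exact huniq M ⟨h1, by omega⟩
  · rintro rfl
    exact ⟨hL.1, by omega⟩

theorem numLines_succ [Fintype Γ.Line]
    (hΓ : Γ.IsGenHexagon) (hO : Γ.HasOrder s t) {x y : Γ.Point} {k : ℕ}
    (hy : Γ.ptDist x y = k + 1) (h6 : Γ.ptDist x y ≠ 6) : Γ.numLines x (k + 2) y = t := by
  have h1 := numLines_pred hΓ hy h6
  have h2 := hO.card_lines y
  have h3 : Γ.numLines x k y + Γ.numLines x (k + 2) y = t + 1 := by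
    rw [← h2, numLines, numLines, ← Finset.card_union_of_disjoint]
    · congr 1
      ext L
      simp only [Finset.mem_union, Finset.mem_filter, Finset.mem_univ, true_and, ← and_or_left,
        and_iff_left_iff_imp]
      intro hL
      have := hΓ.ptDist_lineDist_of_mem x hL
      omega
    · rw [Finset.disjoint_left]
      simp only [Finset.mem_filter, Finset.mem_univ, true_and]
      omega
  omega

/-- The sum of `f` over the points at distance `k` from `x`. -/
noncomputable def sphereSum (Γ : GenHexagon) [Fintype Γ.Point] (f : Γ.Point → ℚ) (x : Γ.Point)
    (k : ℕ) : ℚ :=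
  ∑ y with Γ.ptDist x y = k, f y

/-- On each line, `f` sums over the points farthest from `x` to `c` times its value at the
nearest point. -/
theorem sum_far_eq [Fintype Γ.Point] (hΓ : Γ.IsGenHexagon) {f : Γ.Point → ℚ} {c : ℚ}
    (hf : ∀ L, ∀ w ∈ Γ.pts L, ∑ y with y ∈ Γ.pts L, f y = (c + 1) * f w) (x : Γ.Point)
    {L : Γ.Line} {k : ℕ} (hL : Γ.lineDist x L = k + 1) :
    ∑ y with y ∈ Γ.pts L ∧ Γ.ptDist x y = k + 2, f y =
      c * ∑ y with y ∈ Γ.pts L ∧ Γ.ptDist x y = k, f y := by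
  obtain ⟨w, hw, huniq⟩ := hΓ.existsUnique_mem_pts x L
  have hnear : (Finset.univ.filter fun y => y ∈ Γ.pts L ∧ Γ.ptDist x y = k) = {w} := by
    ext y
    simp only [Finset.mem_filter, Finset.mem_univ, true_and, Finset.mem_singleton]
    constructor
    · rintro ⟨h1, h2⟩
      exact huniq y ⟨h1, by omega⟩
    · rintro rfl
      exact ⟨hw.1, by omega⟩
  have hsplit : (Finset.univ.filter fun y => y ∈ Γ.pts L) =
      (Finset.univ.filter fun y => y ∈ Γ.pts L ∧ Γ.ptDist x y = k) ∪
      (Finset.univ.filter fun y => y ∈ Γ.pts L ∧ Γ.ptDist x y = k + 2) := by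
    ext y
    simp only [Finset.mem_union, Finset.mem_filter, Finset.mem_univ, true_and, ← and_or_left,
      iff_self_and]
    intro hy
    have := hΓ.ptDist_lineDist_of_mem x hy
    omega
  have hsum := hf L w hw.1
  rw [hsplit, Finset.sum_union, hnear, Finset.sum_singleton] at hsum
  · rw [hnear, Finset.sum_singleton]
    linarith
  · rw [Finset.disjoint_left]
    simp only [Finset.mem_filter, Finset.mem_univ, true_and]
    omega

/-- Double counting of the flags between consecutive spheres around `x`. -/
theorem sum_numLines_mul [Fintype Γ.Point] [Fintype Γ.Line]
    (hΓ : Γ.IsGenHexagon) {f : Γ.Point → ℚ} {c : ℚ}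
    (hf : ∀ L, ∀ w ∈ Γ.pts L, ∑ y with y ∈ Γ.pts L, f y = (c + 1) * f w) (x : Γ.Point) (k : ℕ) :
    ∑ y with Γ.ptDist x y = k + 2, (Γ.numLines x (k + 1) y : ℚ) * f y =
      c * ∑ y with Γ.ptDist x y = k, (Γ.numLines x (k + 1) y : ℚ) * f y := by
  have hswap : ∀ j : ℕ, ∑ y with Γ.ptDist x y = j, (Γ.numLines x (k + 1) y : ℚ) * f y =
      ∑ L with Γ.lineDist x L = k + 1, ∑ y with y ∈ Γ.pts L ∧ Γ.ptDist x y = j, f y := by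
    intro j
    simp only [numLines, ← nsmul_eq_mul, ← Finset.sum_const]
    refine Finset.sum_comm' ?_
    intro y L
    simp only [Finset.mem_filter, Finset.mem_univ, true_and]
    tauto
  rw [hswap, hswap, Finset.mul_sum]
  refine Finset.sum_congr rfl fun L hL => ?_
  exact sum_far_eq hΓ hf x (by simpa using hL)

theorem sphereSum_zero [Fintype Γ.Point] (hΓ : Γ.IsGenHexagon) (f : Γ.Point → ℚ) (x : Γ.Point) :
    Γ.sphereSum f x 0 = f x := by
  simp [sphereSum, hΓ.ptDist_eq_zero_iff, Finset.filter_eq]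

theorem sum_numLines_mul_eq [Fintype Γ.Point] [Fintype Γ.Line]
    {f : Γ.Point → ℚ} {x : Γ.Point} {j k n : ℕ}
    (h : ∀ y, Γ.ptDist x y = j → Γ.numLines x k y = n) :
    ∑ y with Γ.ptDist x y = j, (Γ.numLines x k y : ℚ) * f y = n * Γ.sphereSum f x j := by
  rw [sphereSum, Finset.mul_sum]
  refine Finset.sum_congr rfl fun y hy => ?_
  rw [h y (by simpa using hy)]

/-- The sums over the spheres around `x` of a function for which the line sums are proportional
to each value on the line. -/
theorem sphereSum_eq [Fintype Γ.Point] [Fintype Γ.Line]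
    (hΓ : Γ.IsGenHexagon) (hO : Γ.HasOrder s t) {f : Γ.Point → ℚ} {c : ℚ}
    (hf : ∀ L, ∀ w ∈ Γ.pts L, ∑ y with y ∈ Γ.pts L, f y = (c + 1) * f w) (x : Γ.Point) :
    Γ.sphereSum f x 2 = c * (t + 1) * f x ∧ Γ.sphereSum f x 4 = c ^ 2 * t * (t + 1) * f x ∧
      Γ.sphereSum f x 6 = c ^ 3 * t ^ 2 * f x := by
  have h0 := sum_numLines_mul hΓ hf x 0
  have h2 := sum_numLines_mul hΓ hf x 2
  have h4 := sum_numLines_mul hΓ hf x 4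
  rw [sum_numLines_mul_eq (n := 1) fun y hy => numLines_pred hΓ hy (by omega),
    sum_numLines_mul_eq (n := t + 1) fun y hy => numLines_of_forall hO fun L hL => by
      have := hΓ.ptDist_lineDist_of_mem x hL
      omega, sphereSum_zero hΓ] at h0
  rw [sum_numLines_mul_eq (n := 1) fun y hy => numLines_pred hΓ hy (by omega),
    sum_numLines_mul_eq (n := t) fun y hy =>
      numLines_succ (k := 1) hΓ hO hy (by omega)] at h2
  rw [sum_numLines_mul_eq (n := t + 1) fun y hy => numLines_of_forall hO fun L hL => by
      have := hΓ.ptDist_lineDist_of_mem x hL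
      have := hΓ.lineDist_mem x L
      omega,
    sum_numLines_mul_eq (n := t) fun y hy =>
      numLines_succ (k := 3) hΓ hO hy (by omega)] at h4
  push_cast at h0 h2 h4
  have e2 : Γ.sphereSum f x 2 = c * (t + 1) * f x := by linarith
  have e4 : Γ.sphereSum f x 4 = c ^ 2 * t * (t + 1) * f x := by
    rw [e2] at h2
    linarith
  refine ⟨e2, e4, ?_⟩
  rw [e4] at h4
  have ht : (t + 1 : ℚ) ≠ 0 := by positivity
  apply mul_left_cancel₀ ht
  linarith

/-- Summation over all points by distance from `x`. -/
theorem sum_eq_sphereSum [Fintype Γ.Point]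
    (hΓ : Γ.IsGenHexagon) (f : Γ.Point → ℚ) (g : ℕ → ℚ) (x : Γ.Point) :
    ∑ y, g (Γ.ptDist x y) * f y = g 0 * f x + g 2 * Γ.sphereSum f x 2 +
      g 4 * Γ.sphereSum f x 4 + g 6 * Γ.sphereSum f x 6 := by
  have hmaps : ∀ y ∈ (Finset.univ : Finset Γ.Point),
      Γ.ptDist x y ∈ ({0, 2, 4, 6} : Finset ℕ) := by
    intro y _
    simpa using hΓ.ptDist_mem x y
  have hfiber : ∀ k : ℕ, ∑ y with Γ.ptDist x y = k, g (Γ.ptDist x y) * f y =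
      g k * Γ.sphereSum f x k := by
    intro k
    rw [sphereSum, Finset.mul_sum]
    refine Finset.sum_congr rfl fun y hy => ?_
    rw [(Finset.mem_filter.1 hy).2]
  rw [← Finset.sum_fiberwise_of_maps_to hmaps]
  simp [hfiber, sphereSum_zero hΓ]
  ring

/-- The number of points of a generalised hexagon of order `(s, t)`. -/
theorem card_point [Fintype Γ.Point] [Fintype Γ.Line] (hΓ : Γ.IsGenHexagon) (hO : Γ.HasOrder s t) :
    (Fintype.card Γ.Point : ℚ) = (s + 1) * (1 + s * t + s ^ 2 * t ^ 2) := by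
  obtain ⟨x⟩ := hO.nonempty_point hΓ
  obtain ⟨h2, h4, h6⟩ := sphereSum_eq hΓ hO (f := fun _ => 1) (c := s)
    (fun L w _ => by simp [hO.card_pts]) x
  have h := sum_eq_sphereSum hΓ (fun _ => 1) (fun _ => 1) x
  rw [h2, h4, h6] at h
  simp only [mul_one, Finset.sum_const, nsmul_eq_mul, Finset.card_univ] at h
  rw [h]
  ring

/-- Up to scaling, the idempotent of the Bose–Mesner algebra of the collinearity graph for the
eigenvalue `-(t + 1)`. -/
noncomputable def kernel (Γ : GenHexagon) (s : ℕ) : Matrix Γ.Point Γ.Point ℚ :=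
  fun x y => (-(s : ℚ)⁻¹) ^ (Γ.ptDist x y / 2)

theorem kernel_comm (x y : Γ.Point) : Γ.kernel s x y = Γ.kernel s y x := by
  rw [kernel, kernel, ptDist_comm]

theorem sum_kernel_eq_zero [Fintype Γ.Point]
    (hΓ : Γ.IsGenHexagon) (hO : Γ.HasOrder s t) (hs : s ≠ 0)
    (x : Γ.Point) (L : Γ.Line) : ∑ y with y ∈ Γ.pts L, Γ.kernel s x y = 0 := by
  obtain ⟨w, hw, huniq⟩ := hΓ.existsUnique_mem_pts x L
  have hmem : w ∈ Finset.univ.filter (· ∈ Γ.pts L) := by simpa using hw.1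
  have hfar : ∀ y ∈ (Finset.univ.filter (· ∈ Γ.pts L)).erase w,
      Γ.kernel s x y = (-(s : ℚ)⁻¹) ^ (Γ.ptDist x w / 2 + 1) := by
    intro y hy
    simp only [Finset.mem_erase, Finset.mem_filter, Finset.mem_univ, true_and] at hy
    have h1 : Γ.ptDist x y + 1 ≠ Γ.lineDist x L := fun h => hy.1 (huniq y ⟨hy.2, h⟩)
    have h2 := hΓ.ptDist_lineDist_of_mem x hy.2
    rw [kernel]
    congr 1
    omega
  rw [← Finset.add_sum_erase _ _ hmem, Finset.sum_congr rfl hfar, Finset.sum_const,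
    Finset.card_erase_of_mem hmem, hO.card_pts, kernel, nsmul_eq_mul, pow_succ]
  have hs' : (s : ℚ) ≠ 0 := by exact_mod_cast hs
  simp only [Nat.add_sub_cancel]
  field_simp
  ring

theorem kernel_mul_kernel [Fintype Γ.Point] [Fintype Γ.Line]
    (hΓ : Γ.IsGenHexagon) (hO : Γ.HasOrder s t) (hs : s ≠ 0) :
    Γ.kernel s * Γ.kernel s =
      (((s + 1) * (s ^ 2 + s * t + t ^ 2) / s ^ 3 : ℚ)) • Γ.kernel s := by
  ext x z
  obtain ⟨h2, h4, h6⟩ := sphereSum_eq hΓ hO (f := fun y => Γ.kernel s y z) (c := -1)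
    (fun L w _ => by simp [kernel_comm _ z, sum_kernel_eq_zero hΓ hO hs]) x
  have h := sum_eq_sphereSum hΓ (fun y => Γ.kernel s y z) (fun k => (-(s : ℚ)⁻¹) ^ (k / 2)) x
  rw [h2, h4, h6] at h
  rw [Matrix.mul_apply, Matrix.smul_apply, smul_eq_mul]
  refine Eq.trans h ?_
  have hs' : (s : ℚ) ≠ 0 := by exact_mod_cast hs
  norm_num
  field_simp
  ring

/-- The Feit–Higman integrality condition for the multiplicity of the least eigenvalue. -/
theorem dvd_of_hasOrder [Fintype Γ.Point] [Fintype Γ.Line]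
    (hΓ : Γ.IsGenHexagon) (hO : Γ.HasOrder s t) (hs : s ≠ 0) :
    s ^ 2 + s * t + t ^ 2 ∣ s ^ 3 * (1 + s * t + s ^ 2 * t ^ 2) := by
  have hs' : (0 : ℚ) < s := by exact_mod_cast Nat.pos_of_ne_zero hs
  obtain ⟨m, hm⟩ := Matrix.exists_nat_trace_eq_mul (by positivity) (kernel_mul_kernel hΓ hO hs)
  have htr : (Γ.kernel s).trace = Fintype.card Γ.Point := by
    simp [Matrix.trace, kernel, ptDist_self]
  rw [htr, card_point hΓ hO] at hm
  refine ⟨m, ?_⟩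
  have key : (s : ℚ) ^ 3 * (1 + s * t + s ^ 2 * t ^ 2) = (s ^ 2 + s * t + t ^ 2) * m := by
    have hs1 : (s + 1 : ℚ) ≠ 0 := by positivity
    apply mul_left_cancel₀ hs1
    field_simp at hm ⊢
    linarith
  exact_mod_cast key

end Counting

end GenHexagon

theorem not_dvd_of_eq_add_sq {t : ℕ} (ht : 2 ≤ t) :
    ¬ (t + t ^ 2) ^ 2 + (t + t ^ 2) * t + t ^ 2 ∣
      (t + t ^ 2) ^ 3 * (1 + (t + t ^ 2) * t + (t + t ^ 2) ^ 2 * t ^ 2) := by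
  intro h
  have h1 : t ^ 2 * (t ^ 2 + 3 * t + 3) ∣
      t ^ 2 * (t * (t + 1) ^ 3 * (1 + t ^ 2 * (t + 1) + t ^ 4 * (t + 1) ^ 2)) := by
    convert h using 1 <;> ring
  have h2 := Nat.dvd_of_mul_dvd_mul_left (by positivity) h1
  have h3 : ((t : ℤ) ^ 2 + 3 * t + 3) ∣
      (t : ℤ) * (t + 1) ^ 3 * (1 + t ^ 2 * (t + 1) + t ^ 4 * (t + 1) ^ 2) := by exact_mod_cast h2
  have h4 : ((t : ℤ) ^ 2 + 3 * t + 3) ∣ 4 * (5 * (t : ℤ) + 9) := by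
    have h5 : (4 * (5 * t + 9) : ℤ) =
        (t ^ 2 + 3 * t + 3) *
          (t ^ 8 + 2 * t ^ 7 + t ^ 6 + 2 * t ^ 5 + t ^ 3 + 2 * t ^ 2 - 5 * t + 12) -
        (t : ℤ) * (t + 1) ^ 3 * (1 + t ^ 2 * (t + 1) + t ^ 4 * (t + 1) ^ 2) := by ring
    rw [h5]
    exact (dvd_mul_right _ _).sub h3
  have h6 : t ^ 2 + 3 * t + 3 ∣ 4 * (5 * t + 9) := by exact_mod_cast h4
  have hodd : Nat.Coprime (t ^ 2 + 3 * t + 3) 4 := by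
    have : Odd (t ^ 2 + 3 * t + 3) := by
      have := Nat.even_mul_succ_self t
      obtain ⟨k, hk⟩ := this
      exact ⟨k + t + 1, by nlinarith⟩
    exact (Nat.coprime_two_right.2 this).pow_right 2
  have h7 := hodd.dvd_of_dvd_mul_left h6
  have h8 := Nat.le_of_dvd (by positivity) h7
  have h9 : t ≤ 3 := by nlinarith
  interval_cases t <;> omega

/-- There is no generalised hexagon of order `(s, t)` with `s = t + t²` and `t ≥ 2`. -/
theorem no_genHexagon_of_order_t_add_t_sq (t : ℕ) (ht : 2 ≤ t) :
    ¬ ∃ Γ : GenHexagon, Γ.IsGenHexagon ∧ Γ.HasOrder (t + t ^ 2) t := by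
  rintro ⟨Γ, hΓ, hO⟩
  have := hO.finite_vertex hΓ
  have : Finite Γ.Point := Finite.of_injective _ (Sum.inl_injective (β := Γ.Line))
  have : Finite Γ.Line := Finite.of_injective _ (Sum.inr_injective (α := Γ.Point))
  have := Fintype.ofFinite Γ.Point
  have := Fintype.ofFinite Γ.Line
  exact not_dvd_of_eq_add_sq ht (GenHexagon.dvd_of_hasOrder hΓ hO (by omega))
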